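/- Let m > 0 and σ > 0, and let ν = gaussianReal m σ² be the Gaussian measure on ℝ with mean m and variance σ². Define h : ℝ → ℝ by h(α) = α·∫ tanh(α·y) dν(y) − α²·m·∫ (1 − tanh(α·y)²) dν(y). Then for every α > 0 satisfying α²(m² − σ²) − 2α³·m·σ² ≥ 0, there exists c > 0 such that h has derivative c at α (HasDerivAt h c α). -/

import Mathlib

open MeasureTheory ProbabilityTheory

lemma Real.hasDerivAt_tanh (x : ℝ) : HasDerivAt Real.tanh (1 - Real.tanh x ^ 2) x := by
  have hc := (Real.cosh_pos x).ne'
  have h := (Real.hasDerivAt_sinh x).div (Real.hasDerivAt_cosh x) hc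
  refine (h.congr_of_eventuallyEq (Filter.Eventually.of_forall
    Real.tanh_eq_sinh_div_cosh)).congr_deriv ?_
  rw [Real.tanh_eq_sinh_div_cosh]
  field_simp

@[fun_prop]
lemma Real.continuous_tanh : Continuous Real.tanh :=
  continuous_iff_continuousAt.2 fun x => (Real.hasDerivAt_tanh x).continuousAt

lemma Real.tanh_strictMono : StrictMono Real.tanh :=
  strictMono_of_hasDerivAt_pos Real.hasDerivAt_tanh
    fun x => by linarith [Real.tanh_sq_lt_one x]

lemma Real.tanh_pos {x : ℝ} (hx : 0 < x) : 0 < Real.tanh x := by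
  simpa using Real.tanh_strictMono hx

lemma Real.tanh_le_self {x : ℝ} (hx : 0 ≤ x) : Real.tanh x ≤ x := by
  have hd (y : ℝ) : HasDerivAt (fun y => y - Real.tanh y) (1 - (1 - Real.tanh y ^ 2)) y :=
    (hasDerivAt_id y).sub (Real.hasDerivAt_tanh y)
  have hmono : Monotone fun y : ℝ => y - Real.tanh y :=
    monotone_of_hasDerivAt_nonneg hd fun y => by
      simpa using sq_nonneg (Real.tanh y)
  have := hmono hx
  simp only [Real.tanh_zero, sub_zero] at this
  linarith

lemma Real.hasDerivAt_one_sub_tanh_sq (x : ℝ) :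
    HasDerivAt (fun y => 1 - Real.tanh y ^ 2) (-2 * Real.tanh x * (1 - Real.tanh x ^ 2)) x := by
  refine (((Real.hasDerivAt_tanh x).pow 2).const_sub 1).congr_deriv ?_
  push_cast
  ring

lemma Real.tanh_cube_le {x : ℝ} (hx : 0 ≤ x) :
    2 / 3 * Real.tanh x ^ 3 ≤ Real.tanh x - x * (1 - Real.tanh x ^ 2) := by
  let f : ℝ → ℝ := fun y => Real.tanh y - y * (1 - Real.tanh y ^ 2) - 2 / 3 * Real.tanh y ^ 3
  have hd (y : ℝ) : HasDerivAt f
      (2 * Real.tanh y * (1 - Real.tanh y ^ 2) * (y - Real.tanh y)) y := by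
    refine (((Real.hasDerivAt_tanh y).sub
      ((hasDerivAt_id y).mul (Real.hasDerivAt_one_sub_tanh_sq y))).sub
      (((Real.hasDerivAt_tanh y).pow 3).const_mul (2 / 3))).congr_deriv ?_
    simp only [id]
    push_cast
    ring
  have hmono : MonotoneOn f (Set.Ici 0) := by
    refine monotoneOn_of_hasDerivWithinAt_nonneg (convex_Ici 0)
      (fun y _ => (hd y).continuousAt.continuousWithinAt)
      (fun y _ => (hd y).hasDerivWithinAt) fun y hy => ?_
    rw [interior_Ici] at hy
    have h1 := Real.tanh_pos hy
    have h2 := Real.tanh_sq_lt_one y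
    have h3 := Real.tanh_le_self hy.le
    exact mul_nonneg (mul_nonneg (by linarith) (by linarith)) (by linarith)
  have := hmono Set.self_mem_Ici hx hx
  simp only [f, Real.tanh_zero] at this
  linarith

lemma Real.two_mul_tanh_eq (x : ℝ) :
    2 * Real.tanh x = Real.tanh (2 * x) * (1 + Real.tanh x ^ 2) := by
  have hc := (Real.cosh_pos x).ne'
  have hc2 := (Real.cosh_pos (2 * x)).ne'
  simp only [Real.tanh_eq_sinh_div_cosh]
  field_simp
  rw [Real.sinh_two_mul, Real.cosh_two_mul]

namespace ProbabilityTheory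

variable {μ : ℝ} {v : NNReal}

lemma integrable_gaussianReal_comp_tanh (k : ℝ) {p q : ℝ × ℝ → ℝ} (hp : Continuous p)
    (hq : Continuous q) :
    Integrable (fun x => p (Real.tanh x, Real.tanh (k * x)) +
      x * q (Real.tanh x, Real.tanh (k * x))) (gaussianReal μ v) := by
  have hbdd {p : ℝ × ℝ → ℝ} (hp : Continuous p) :
      ∃ C, ∀ x, ‖p (Real.tanh x, Real.tanh (k * x))‖ ≤ C := by
    obtain ⟨C, hC⟩ := ((isCompact_Icc (a := (-1 : ℝ)) (b := 1)).prod
      (isCompact_Icc (a := (-1 : ℝ)) (b := 1))).exists_bound_of_continuousOn hp.continuousOn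
    exact ⟨C, fun x => hC _ ⟨⟨(Real.neg_one_lt_tanh _).le, (Real.tanh_lt_one _).le⟩,
      ⟨(Real.neg_one_lt_tanh _).le, (Real.tanh_lt_one _).le⟩⟩⟩
  have hid : Integrable (fun x : ℝ => x) (gaussianReal μ v) :=
    (memLp_id_gaussianReal 1).integrable le_rfl
  obtain ⟨C, hC⟩ := hbdd hp
  obtain ⟨D, hD⟩ := hbdd hq
  exact (Integrable.of_bound (by fun_prop) C (Filter.Eventually.of_forall hC)).add
    (hid.mul_bdd (by fun_prop) (Filter.Eventually.of_forall hD))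

lemma integrable_gaussianReal_iff (hv : v ≠ 0) {f : ℝ → ℝ} :
    Integrable f (gaussianReal μ v) ↔ Integrable fun x => gaussianPDFReal μ v x * f x := by
  rw [gaussianReal_of_var_ne_zero μ hv, integrable_withDensity_iff_integrable_smul'
    (measurable_gaussianPDF μ v) (Filter.Eventually.of_forall fun _ => gaussianPDF_lt_top)]
  simp

lemma hasDerivAt_gaussianPDFReal (hv : v ≠ 0) (x : ℝ) :
    HasDerivAt (gaussianPDFReal μ v) (-((x - μ) / v) * gaussianPDFReal μ v x) x := by
  have hv' : (v : ℝ) ≠ 0 := by exact_mod_cast hv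
  have h1 : HasDerivAt (fun x : ℝ => -(x - μ) ^ 2 / (2 * v)) (-((x - μ) / v)) x := by
    refine (((((hasDerivAt_id x).sub_const μ).pow 2).neg).div_const (2 * (v : ℝ))).congr_deriv ?_
    simp only [id]
    field_simp
    norm_num [mul_comm]
  rw [gaussianPDFReal_def]
  exact (h1.exp.const_mul (√(2 * Real.pi * v))⁻¹).congr_deriv (by ring)

/-- Stein's identity. -/
lemma integral_gaussianReal_stein (hv : v ≠ 0) {g g' : ℝ → ℝ} (hg : ∀ x, HasDerivAt g (g' x) x)
    (hi : Integrable g (gaussianReal μ v))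
    (hi' : Integrable (fun x => (x - μ) * g x - v * g' x) (gaussianReal μ v)) :
    ∫ x, ((x - μ) * g x - v * g' x) ∂(gaussianReal μ v) = 0 := by
  have hv' : (v : ℝ) ≠ 0 := by exact_mod_cast hv
  rw [integral_gaussianReal_eq_integral_smul hv]
  rw [integrable_gaussianReal_iff hv] at hi hi'
  refine integral_eq_zero_of_hasDerivAt_of_integrable (f := fun x =>
    -(v : ℝ) * (gaussianPDFReal μ v x * g x)) (fun x => ?_) hi' (hi.const_mul _)
  refine (((hasDerivAt_gaussianPDFReal hv x).mul (hg x)).const_mul (-(v : ℝ))).congr_deriv ?_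
  simp only [smul_eq_mul]
  field_simp
  ring

lemma gaussianPDFReal_neg_mul (hv : v ≠ 0) (x : ℝ) :
    gaussianPDFReal μ v (-x) * (1 + Real.tanh (μ / v * x)) =
      gaussianPDFReal μ v x * (1 - Real.tanh (μ / v * x)) := by
  have hv' : (v : ℝ) ≠ 0 := by exact_mod_cast hv
  have hp : gaussianPDFReal μ v (-x) * Real.exp (μ / v * x) =
      gaussianPDFReal μ v x * Real.exp (-(μ / v * x)) := by
    simp only [gaussianPDFReal_def, mul_assoc, ← Real.exp_add]
    congr 2
    field_simp
    ring
  rw [Real.tanh_eq]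
  generalize μ / v * x = y at *
  have h1 := Real.exp_pos y
  have h2 := Real.exp_pos (-y)
  have h3 : Real.exp y + Real.exp (-y) ≠ 0 := by positivity
  field_simp
  linear_combination 2 * hp

lemma integral_gaussianReal_odd_mul_one_sub_tanh (hv : v ≠ 0) {f : ℝ → ℝ} (hf : f.Odd) :
    ∫ x, f x * (1 - Real.tanh (μ / v * x)) ∂(gaussianReal μ v) = 0 := by
  rw [integral_gaussianReal_eq_integral_smul hv]
  have h := integral_neg_eq_self (fun x => gaussianPDFReal μ v x •
    (f x * (1 - Real.tanh (μ / v * x)))) volume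
  have h2 : ∀ x, gaussianPDFReal μ v (-x) • (f (-x) * (1 - Real.tanh (μ / v * (-x)))) =
      - (gaussianPDFReal μ v x • (f x * (1 - Real.tanh (μ / v * x)))) := fun x => by
    have := gaussianPDFReal_neg_mul (μ := μ) hv x
    simp only [hf x, mul_neg, Real.tanh_neg, smul_eq_mul]
    linear_combination (-f x) * this
  simp only [h2, integral_neg] at h
  linarith

lemma integral_gaussianReal_pos {f : ℝ → ℝ} (hv : v ≠ 0) (hf : Integrable f (gaussianReal μ v))
    (h0 : 0 ≤ f 0) (hpos : ∀ x, x ≠ 0 → 0 < f x) : 0 < ∫ x, f x ∂(gaussianReal μ v) := by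
  have := nullSingletonClass_gaussianReal (μ := μ) hv
  rw [integral_pos_iff_support_of_nonneg (fun x => ?_) hf]
  · refine lt_of_lt_of_le ?_ (measure_mono (s := {0}ᶜ) fun x hx => (hpos x hx).ne')
    rw [prob_compl_eq_one_sub (measurableSet_singleton 0)]
    simp
  · rcases eq_or_ne x 0 with rfl | hx
    exacts [h0, (hpos x hx).le]

end ProbabilityTheory

lemma stein_coefficient_pos {μ v w : ℝ} (hμ : 0 < μ) (hv : 0 < v) (hw : 0 < w) (hw1 : w < 1)
    (hcond : 2 * μ * v ≤ μ ^ 2 - v) :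
    0 < 2 / 3 * (1 - w) + 2 * w * (μ ^ 2 - v + 2 * v ^ 2 - 3 * μ * v) + 3 * μ * v * w ^ 2 := by
  have h2v : 2 * v ≤ μ := by
    by_contra! hlt
    nlinarith
  have hq : -(v ^ 2) ≤ μ * (μ ^ 2 - v + 2 * v ^ 2 - 3 * μ * v) := by
    nlinarith [mul_nonneg (sub_nonneg.2 hcond) (by linarith : 0 ≤ μ - v)]
  have key : 0 < μ * (2 / 3 * (1 - w)) - 2 * w * v ^ 2 + 3 * μ ^ 2 * v * w ^ 2 := by
    rcases le_or_gt (2 / 3) w with h | h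
    · have hv2 : v ≤ μ ^ 2 := by nlinarith [mul_pos hμ hv]
      have : 2 * w * v ^ 2 ≤ 3 * μ ^ 2 * v * w ^ 2 := by
        have h1 : 2 * v ≤ 3 * μ ^ 2 * w := by nlinarith [sq_nonneg μ]
        nlinarith [mul_le_mul_of_nonneg_left h1 (mul_pos hw hv).le]
      nlinarith
    · have hX : 0 < v * w := mul_pos hv hw
      have h1 : 2 * w * v ^ 2 ≤ μ * (v * w) := by nlinarith
      have h2 : 6 * μ * (v * w) ^ 2 ≤ 3 * μ ^ 2 * v * w ^ 2 := by
        nlinarith [mul_le_mul_of_nonneg_left h2v (by positivity : 0 ≤ 3 * μ * v * w ^ 2)]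
      have h3 : 0 < 6 * (v * w) ^ 2 - v * w + 2 / 3 * (1 - w) := by
        nlinarith [sq_nonneg (v * w - 1 / 12)]
      nlinarith [mul_pos hμ h3]
  refine pos_of_mul_pos_right (a := μ) ?_ hμ.le
  nlinarith [mul_le_mul_of_nonneg_left hq hw.le]

/-- The odd part, up to Stein's identity, of the integrand of the derivative. -/
noncomputable def oddPart (μ v z : ℝ) : ℝ :=
  (Real.tanh z - z * (1 - Real.tanh z ^ 2)) + 2 * v * (z - Real.tanh z) * (1 - Real.tanh z ^ 2) +
    2 * (μ ^ 2 - v + 2 * v ^ 2) * Real.tanh z * (1 - Real.tanh z ^ 2)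

lemma oddPart_odd (μ v : ℝ) : (oddPart μ v).Odd := fun z => by
  simp only [oddPart, Real.tanh_neg]
  ring

lemma oddPart_mul_tanh_pos {μ v z : ℝ} (hμ : 0 < μ) (hv : 0 < v)
    (hcond : 2 * μ * v ≤ μ ^ 2 - v) (hz : 0 < z) :
    0 < oddPart μ v z * Real.tanh (μ / v * z) -
      6 * μ * v * (1 - Real.tanh z ^ 2) * Real.tanh z ^ 2 := by
  have h2v : 2 ≤ μ / v := by
    rw [le_div_iff₀ hv]
    by_contra! hlt
    nlinarith
  have hT : 2 * Real.tanh z ≤ Real.tanh (μ / v * z) * (1 + Real.tanh z ^ 2) := by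
    rw [Real.two_mul_tanh_eq]
    gcongr
    exact Real.tanh_strictMono.monotone (by gcongr)
  have hTpos : 0 < Real.tanh (μ / v * z) := Real.tanh_pos (by positivity)
  have h1 := Real.tanh_cube_le hz.le
  have h2 := Real.tanh_le_self hz.le
  have ht := Real.tanh_pos hz
  have ht1 := Real.tanh_sq_lt_one z
  unfold oddPart
  generalize Real.tanh z = t at *
  generalize Real.tanh (μ / v * z) = T at *
  have hw : 0 < 1 - t ^ 2 := by linarith
  have hq := stein_coefficient_pos hμ hv hw (by nlinarith) hcond
  have h3 : 0 ≤ 2 * v * (z - t) * (1 - t ^ 2) :=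
    mul_nonneg (mul_nonneg (by positivity) (by linarith)) hw.le
  have h4 : 6 * μ * v * (1 - t ^ 2) * t ^ 2 ≤
      T * (3 * μ * v * (1 - t ^ 2) * t * (1 + t ^ 2)) := by
    have : 0 ≤ 3 * μ * v * (1 - t ^ 2) * t := by positivity
    nlinarith [mul_le_mul_of_nonneg_left hT this]
  have h5 : 0 < (t - z * (1 - t ^ 2)) + 2 * v * (z - t) * (1 - t ^ 2) +
      2 * (μ ^ 2 - v + 2 * v ^ 2) * t * (1 - t ^ 2) -
      3 * μ * v * (1 - t ^ 2) * t * (1 + t ^ 2) := by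
    nlinarith [mul_pos ht hq]
  nlinarith [mul_pos hTpos h5]

/-- Positivity of the Gaussian integral to which the derivative in `stmt17` rescales. -/
lemma integral_tanh_gaussianReal_pos {μ : ℝ} {v : NNReal} (hμ : 0 < μ) (hv : 0 < v)
    (hcond : 2 * μ * v ≤ μ ^ 2 - v) :
    0 < ∫ z, (Real.tanh z + z * (1 - Real.tanh z ^ 2) - 2 * μ * (1 - Real.tanh z ^ 2) +
      2 * μ * (z * Real.tanh z * (1 - Real.tanh z ^ 2))) ∂(gaussianReal μ v) := by
  have hv' : (0 : ℝ) < v := hv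
  let g : ℝ → ℝ := fun z => (2 * (1 - v) + 2 * μ * Real.tanh z) * (1 - Real.tanh z ^ 2)
  let g' : ℝ → ℝ := fun z => 2 * μ * (1 - Real.tanh z ^ 2) * (1 - Real.tanh z ^ 2) +
    (2 * (1 - v) + 2 * μ * Real.tanh z) * (-2 * Real.tanh z * (1 - Real.tanh z ^ 2))
  let E : ℝ → ℝ := fun z => oddPart μ v z * Real.tanh (μ / v * z) -
      6 * μ * v * (1 - Real.tanh z ^ 2) * Real.tanh z ^ 2
  let O : ℝ → ℝ := fun z => oddPart μ v z * (1 - Real.tanh (μ / v * z))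
  have hg (z : ℝ) : HasDerivAt g (g' z) z :=
    (((Real.hasDerivAt_tanh z).const_mul (2 * μ)).const_add (2 * (1 - (v : ℝ)))).mul
      (Real.hasDerivAt_one_sub_tanh_sq z)
  have hgi : Integrable g (gaussianReal μ v) := by
    refine (integrable_gaussianReal_comp_tanh 0
      (p := fun x => (2 * (1 - v) + 2 * μ * x.1) * (1 - x.1 ^ 2)) (q := fun _ => 0)
      (by fun_prop) (by fun_prop)).congr (Filter.Eventually.of_forall fun z => ?_)
    simp [g]
  have hSi : Integrable (fun z => (z - μ) * g z - v * g' z) (gaussianReal μ v) := by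
    refine (integrable_gaussianReal_comp_tanh 0
      (p := fun x => -μ * ((2 * (1 - v) + 2 * μ * x.1) * (1 - x.1 ^ 2)) -
        v * (2 * μ * (1 - x.1 ^ 2) * (1 - x.1 ^ 2) +
          (2 * (1 - v) + 2 * μ * x.1) * (-2 * x.1 * (1 - x.1 ^ 2))))
      (q := fun x => (2 * (1 - v) + 2 * μ * x.1) * (1 - x.1 ^ 2))
      (by fun_prop) (by fun_prop)).congr (Filter.Eventually.of_forall fun z => ?_)
    simp only [g, g']
    ring
  have hEi : Integrable E (gaussianReal μ v) := by
    refine (integrable_gaussianReal_comp_tanh (μ / v)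
      (p := fun x => (x.1 - 2 * v * x.1 * (1 - x.1 ^ 2) +
        2 * (μ ^ 2 - v + 2 * v ^ 2) * x.1 * (1 - x.1 ^ 2)) * x.2 -
          6 * μ * v * (1 - x.1 ^ 2) * x.1 ^ 2)
      (q := fun x => (2 * v - 1) * (1 - x.1 ^ 2) * x.2)
      (by fun_prop) (by fun_prop)).congr (Filter.Eventually.of_forall fun z => ?_)
    simp only [E, oddPart]
    ring
  have hOi : Integrable O (gaussianReal μ v) := by
    refine (integrable_gaussianReal_comp_tanh (μ / v)
      (p := fun x => (x.1 - 2 * v * x.1 * (1 - x.1 ^ 2) +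
        2 * (μ ^ 2 - v + 2 * v ^ 2) * x.1 * (1 - x.1 ^ 2)) * (1 - x.2))
      (q := fun x => (2 * v - 1) * (1 - x.1 ^ 2) * (1 - x.2))
      (by fun_prop) (by fun_prop)).congr (Filter.Eventually.of_forall fun z => ?_)
    simp only [O, oddPart]
    ring
  have hsplit : ∫ z, (Real.tanh z + z * (1 - Real.tanh z ^ 2) - 2 * μ * (1 - Real.tanh z ^ 2) +
      2 * μ * (z * Real.tanh z * (1 - Real.tanh z ^ 2))) ∂(gaussianReal μ v) =
      ∫ z, (E z + O z + ((z - μ) * g z - v * g' z)) ∂(gaussianReal μ v) := by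
    congr 1 with z
    simp only [E, O, g, g', oddPart]
    ring
  rw [hsplit, integral_add (show Integrable (fun z => E z + O z) _ from hEi.add hOi) hSi, integral_add hEi hOi,
    integral_gaussianReal_stein hv.ne' hg hgi hSi,
    integral_gaussianReal_odd_mul_one_sub_tanh hv.ne' (oddPart_odd μ v), add_zero, add_zero]
  refine integral_gaussianReal_pos hv.ne' hEi (by simp [E]) fun z hz => ?_
  rcases hz.lt_or_gt with hz | hz
  · have := oddPart_mul_tanh_pos hμ hv' hcond (neg_pos.2 hz)
    simpa [E, oddPart_odd μ v z, Real.tanh_neg] using this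
  · exact oddPart_mul_tanh_pos hμ hv' hcond hz

lemma hasDerivAt_integral_comp_mul {ν : Measure ℝ} [IsFiniteMeasure ν]
    (hν : Integrable (fun y => y) ν) {f f' : ℝ → ℝ} (hf : ∀ x, HasDerivAt f (f' x) x)
    (hf' : Continuous f') {C D : ℝ} (hC : ∀ x, |f x| ≤ C) (hD : ∀ x, |f' x| ≤ D) (α : ℝ) :
    Integrable (fun y => y * f' (α * y)) ν ∧
      HasDerivAt (fun α => ∫ y, f (α * y) ∂ν) (∫ y, y * f' (α * y) ∂ν) α := by
  have hfc : Continuous f := continuous_iff_continuousAt.2 fun x => (hf x).continuousAt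
  refine hasDerivAt_integral_of_dominated_loc_of_deriv_le (F := fun α y => f (α * y))
    (F' := fun α y => y * f' (α * y)) (s := Set.univ) (bound := fun y => |y| * D) Filter.univ_mem
    (Filter.Eventually.of_forall fun a => by fun_prop)
    (Integrable.of_bound (by fun_prop) C (Filter.Eventually.of_forall fun y => hC _))
    (by fun_prop) (Filter.Eventually.of_forall fun y a _ => ?_) (hν.abs.mul_const D)
    (Filter.Eventually.of_forall fun y a _ => ?_)
  · rw [norm_mul]
    exact mul_le_mul_of_nonneg_left (hD _) (abs_nonneg y)
  · refine ((hf (a * y)).comp a ((hasDerivAt_id a).mul_const y)).congr_deriv ?_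
    ring

/-- For `ν = gaussianReal m σ²` with `m > 0`, `σ > 0`, define
`h(α) = α·E_ν[tanh(αy)] − α²m·E_ν[1 − tanh(αy)²]`. For every `α > 0` with
`α²(m² − σ²) − 2α³mσ² ≥ 0`, `h` has some strictly positive derivative `c` at `α`. -/
theorem stmt17 (m : ℝ) (hm : 0 < m) (σ : NNReal) (hσ : 0 < σ)
    (h : ℝ → ℝ)
    (hh : h = fun α => α * (∫ y, Real.tanh (α * y) ∂(gaussianReal m (σ ^ 2))) -
      α ^ 2 * m * ∫ y, (1 - Real.tanh (α * y) ^ 2) ∂(gaussianReal m (σ ^ 2)))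
    (α : ℝ) (hα : 0 < α)
    (hcond : 0 ≤ α ^ 2 * (m ^ 2 - (σ : ℝ) ^ 2) - 2 * α ^ 3 * m * (σ : ℝ) ^ 2) :
    ∃ c > 0, HasDerivAt h c α := by
  have hid : Integrable (fun y : ℝ => y) (gaussianReal m (σ ^ 2)) :=
    (memLp_id_gaussianReal 1).integrable le_rfl
  obtain ⟨hi1, hd1⟩ := hasDerivAt_integral_comp_mul hid Real.hasDerivAt_tanh (by fun_prop)
    (C := 1) (D := 1) (fun x => (Real.abs_tanh_lt_one x).le)
    (fun x => abs_le.2 ⟨by linarith [Real.tanh_sq_lt_one x], by linarith [sq_nonneg (Real.tanh x)]⟩)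
    α
  have hs (x : ℝ) : |1 - Real.tanh x ^ 2| ≤ 1 :=
    abs_le.2 ⟨by linarith [Real.tanh_sq_lt_one x], by linarith [sq_nonneg (Real.tanh x)]⟩
  obtain ⟨hi2, hd2⟩ := hasDerivAt_integral_comp_mul hid Real.hasDerivAt_one_sub_tanh_sq
    (by fun_prop) (C := 1) (D := 2) hs (fun x => by
      rw [abs_mul, abs_mul, abs_neg, abs_two]
      nlinarith [hs x, abs_nonneg (1 - Real.tanh x ^ 2), (Real.abs_tanh_lt_one x).le,
        abs_nonneg (Real.tanh x)]) α
  have hi3 : Integrable (fun y => Real.tanh (α * y)) (gaussianReal m (σ ^ 2)) :=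
    Integrable.of_bound (by fun_prop) 1
      (Filter.Eventually.of_forall fun y => (Real.abs_tanh_lt_one _).le)
  have hi4 : Integrable (fun y => 1 - Real.tanh (α * y) ^ 2) (gaussianReal m (σ ^ 2)) :=
    Integrable.of_bound (by fun_prop) 1 (Filter.Eventually.of_forall fun y => hs _)
  have hpos := integral_tanh_gaussianReal_pos (μ := α * m)
    (v := .mk (α ^ 2) (sq_nonneg _) * σ ^ 2) (by positivity)
    (mul_pos (show (0 : ℝ) < α ^ 2 by positivity) (by positivity)) (by
      push_cast
      linarith)
  rw [← gaussianReal_map_const_mul, integral_map (by fun_prop) (by fun_prop)] at hpos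
  refine ⟨_, hpos, ?_⟩
  rw [hh]
  refine (((hasDerivAt_id α).mul hd1).sub
    (((hasDerivAt_pow 2 α).mul_const m).mul hd2)).congr_deriv ?_
  simp only [id, ← integral_const_mul]
  rw [← integral_add (by fun_prop) (by fun_prop), ← integral_add (by fun_prop) (by fun_prop),
    ← integral_sub (by fun_prop) (by fun_prop)]
  congr 1 with y
  push_cast
  ring
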